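/- Let w, (p_k), (h_k), q̂_k and the averages ⟨·⟩_n be as in the context. Let S ≥ 1, n ≥ S + 1, let b_1,…,b_S be pairwise distinct complex numbers in ℂ \ ℝ and c_1,…,c_S be pairwise distinct complex numbers in ℂ \ ℝ, with c_ℓ ≠ b_j for all ℓ, j. Then ⟨ ∏_{j=1}^S ∏_{i=1}^n 1/((b_j − x_i)(c_j − x_i)) ⟩_n = (−1)^S · ( h_{n−S−1}^S · ∏_{ℓ=n−S}^{n−1} h_ℓ )^{−1} · det[ ( q̂_{n−S}(c_ℓ) q̂_{n−S−1}(b_j) − q̂_{n−S−1}(c_ℓ) q̂_{n−S}(b_j) ) / (c_ℓ − b_j) ]_{ℓ,j=1}^S / ( Δ(c) Δ(b) ), where Δ(b) := ∏_{1≤j<k≤S}(b_j − b_k) and Δ(c) := ∏_{1≤j<k≤S}(c_j − c_k). -/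

import Mathlib

open Finset MeasureTheory

/-- The Vandermonde-type product `Δ(v) = ∏_{j<k} (v_j - v_k)` (complex points). -/
noncomputable def vdmC {m : ℕ} (v : Fin m → ℂ) : ℂ :=
  ∏ p ∈ Finset.univ.filter (fun p : Fin m × Fin m => p.1 < p.2), (v p.1 - v p.2)

/-- The Vandermonde-type product `Δ(x) = ∏_{i<j} (x_i - x_j)` (real points). -/
noncomputable def vdmR {m : ℕ} (v : Fin m → ℝ) : ℝ :=
  ∏ p ∈ Finset.univ.filter (fun p : Fin m × Fin m => p.1 < p.2), (v p.1 - v p.2)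

/-- The Cauchy transform `q̂_k(z) = ∫_ℝ p_k(x) w(x)/(x - z) dx`. -/
noncomputable def qhat (w : ℝ → ℝ) (p : ℕ → Polynomial ℝ) (k : ℕ) (z : ℂ) : ℂ :=
  ∫ x : ℝ, (((p k).eval x * w x : ℝ) : ℂ) / ((x : ℂ) - z)

section Orthogonal

open Polynomial

/-- A polynomial of degree less than `m` is a combination of the first `m` members of a monic
sequence with `natDegree (p k) = k`. -/
lemma exists_eq_sum_of_degree_lt {p : ℕ → ℝ[X]} (hm : ∀ k, (p k).Monic)
    (hd : ∀ k, (p k).natDegree = k) (m : ℕ) (f : ℝ[X]) (hf : f.degree < m) :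
    ∃ a : ℕ → ℝ, f = ∑ j ∈ range m, a j • p j := by
  induction m generalizing f with
  | zero => exact ⟨0, by simpa using hf⟩
  | succ m ih =>
    have hg : (f - f.coeff m • p m).degree < m := by
      rw [degree_lt_iff_coeff_zero]
      intro i hi
      rcases hi.eq_or_lt with rfl | hi
      · have h1 : (p m).coeff m = 1 := by
          have := (hm m).coeff_natDegree
          rwa [hd] at this
        simp [h1]
      · rw [coeff_sub, coeff_smul,
          coeff_eq_zero_of_natDegree_lt (n := i) (p := p m) (by rw [hd]; exact hi),
          (degree_lt_iff_coeff_zero f (m + 1)).1 (by exact_mod_cast hf) i hi]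
        simp
    obtain ⟨a, ha⟩ := ih _ hg
    refine ⟨Function.update a m (f.coeff m), ?_⟩
    rw [sum_range_succ, Function.update_self, ← sub_eq_iff_eq_add, ha]
    refine sum_congr rfl fun j hj => ?_
    rw [Function.update_of_ne (mem_range.1 hj).ne]

variable {p : ℕ → ℝ[X]} {h : ℕ → ℝ} {L : ℝ[X] →ₗ[ℝ] ℝ}

lemma map_mul_eq_zero_of_degree_lt (hm : ∀ k, (p k).Monic) (hd : ∀ k, (p k).natDegree = k)
    (ho : ∀ j k, j ≠ k → L (p j * p k) = 0) (k : ℕ) (f : ℝ[X]) (hf : f.degree < k) :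
    L (p k * f) = 0 := by
  obtain ⟨a, rfl⟩ := exists_eq_sum_of_degree_lt hm hd k f hf
  rw [mul_sum, map_sum]
  refine sum_eq_zero fun j hj => ?_
  rw [mul_smul_comm, map_smul, ho k j (mem_range.1 hj).ne', smul_zero]

lemma eq_zero_of_map_mul_eq_zero (hm : ∀ k, (p k).Monic) (hd : ∀ k, (p k).natDegree = k)
    (ho : ∀ j k, j ≠ k → L (p j * p k) = 0) (hh : ∀ k, L (p k * p k) = h k)
    (hh0 : ∀ k, h k ≠ 0) (m : ℕ) (f : ℝ[X]) (hf : f.degree < m)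
    (h0 : ∀ j < m, L (p j * f) = 0) : f = 0 := by
  obtain ⟨a, rfl⟩ := exists_eq_sum_of_degree_lt hm hd m f hf
  refine sum_eq_zero fun j hj => ?_
  have h1 := h0 j (mem_range.1 hj)
  rw [mul_sum, map_sum, sum_eq_single_of_mem j hj] at h1
  · rw [mul_smul_comm, map_smul, hh, smul_eq_mul, mul_eq_zero, or_iff_left (hh0 j)] at h1
    rw [h1, zero_smul]
  · intro i _ hij
    rw [mul_smul_comm, map_smul, ho _ _ hij.symm, smul_zero]

lemma degree_X_mul_sub_lt (hm : ∀ k, (p k).Monic) (hd : ∀ k, (p k).natDegree = k) (k : ℕ) :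
    (X * p k - p (k + 1)).degree < ((k + 1 : ℕ) : WithBot ℕ) := by
  have h1 : (X * p k).Monic := monic_X.mul (hm k)
  have h2 : (X * p k).degree = ((k + 1 : ℕ) : WithBot ℕ) := by
    rw [degree_eq_natDegree h1.ne_zero, monic_X.natDegree_mul (hm k), natDegree_X, hd, add_comm]
  have h3 : (p (k + 1)).degree = ((k + 1 : ℕ) : WithBot ℕ) := by
    rw [degree_eq_natDegree (hm _).ne_zero, hd]
  rw [← h2]
  exact degree_sub_lt_left (h2.trans h3.symm) h1.ne_zero (by rw [h1.leadingCoeff, (hm _).leadingCoeff])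

lemma degree_lt_of_monic (hm : ∀ k, (p k).Monic) (hd : ∀ k, (p k).natDegree = k) {j k : ℕ}
    (hjk : j < k) : (p j).degree < k := by
  rw [degree_eq_natDegree (hm _).ne_zero, hd]
  exact_mod_cast hjk

lemma recurrence_zero (hm : ∀ k, (p k).Monic) (hd : ∀ k, (p k).natDegree = k) :
    ∃ α : ℝ, X * p 0 = p 1 + α • p 0 := by
  obtain ⟨a, ha⟩ := exists_eq_sum_of_degree_lt hm hd 1 _ (degree_X_mul_sub_lt hm hd 0)
  exact ⟨a 0, by rw [sub_eq_iff_eq_add] at ha; simpa [add_comm] using ha⟩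

/-- The three-term recurrence for monic orthogonal polynomials. -/
lemma recurrence_succ (hm : ∀ k, (p k).Monic) (hd : ∀ k, (p k).natDegree = k)
    (ho : ∀ j k, j ≠ k → L (p j * p k) = 0) (hh : ∀ k, L (p k * p k) = h k)
    (hh0 : ∀ k, h k ≠ 0) (k : ℕ) :
    ∃ α : ℝ, X * p (k + 1) = p (k + 2) + α • p (k + 1) + (h (k + 1) / h k) • p k := by
  refine ⟨L (p (k + 1) * (X * p (k + 1))) / h (k + 1), ?_⟩
  rw [← sub_eq_zero]
  have hsub (f g₁ g₂ g₃ : ℝ[X]) : f - (g₁ + g₂ + g₃) = f - g₁ - g₂ - g₃ := by ring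
  rw [hsub]
  refine eq_zero_of_map_mul_eq_zero hm hd ho hh hh0 (k + 2) _ ?_ ?_
  · refine (degree_sub_le _ _).trans_lt (max_lt ((degree_sub_le _ _).trans_lt (max_lt
      (degree_X_mul_sub_lt hm hd (k + 1)) ?_)) ?_)
    · exact (degree_smul_le _ _).trans_lt (degree_lt_of_monic hm hd (by omega))
    · exact (degree_smul_le _ _).trans_lt (degree_lt_of_monic hm hd (by omega))
  · intro j hj
    simp only [mul_sub, map_sub, mul_smul_comm, map_smul, smul_eq_mul]
    rw [ho j (k + 2) hj.ne]
    rcases (Nat.lt_succ_iff.1 hj).eq_or_lt with rfl | hj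
    · rw [hh, ho (k + 1) k (by omega)]
      field_simp [hh0 (k + 1)]
      ring
    rw [ho j (k + 1) hj.ne, show p j * (X * p (k + 1)) = p (k + 1) * (X * p j) by ring]
    rcases (Nat.lt_succ_iff.1 hj).eq_or_lt with rfl | hj
    · have h1 := map_mul_eq_zero_of_degree_lt hm hd ho (j + 1) _ (degree_X_mul_sub_lt hm hd j)
      rw [mul_sub, map_sub, hh, sub_eq_zero] at h1
      rw [h1, hh]
      field_simp [hh0 j]
      ring
    · rw [ho j k hj.ne, map_mul_eq_zero_of_degree_lt hm hd ho]
      · ring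
      · rw [degree_eq_natDegree (monic_X.mul (hm j)).ne_zero, monic_X.natDegree_mul (hm j),
          natDegree_X, hd]
        exact_mod_cast (by omega : 1 + j < k + 1)

/-- The Christoffel–Darboux formula for functionals of Cauchy-transform type. -/
lemma christoffel_darboux_functional (hm : ∀ k, (p k).Monic) (hd : ∀ k, (p k).natDegree = k)
    (ho : ∀ j k, j ≠ k → L (p j * p k) = 0) (hh : ∀ k, L (p k * p k) = h k)
    (hh0 : ∀ k, h k ≠ 0) {b c : ℂ} {Q R : ℝ[X] →ₗ[ℝ] ℂ}
    (hQ : ∀ f, Q (X * f) = c * Q f + L f) (hR : ∀ f, R (X * f) = b * R f + L f) (N : ℕ) :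
    (Q (p (N + 1)) * R (p N) - Q (p N) * R (p (N + 1))) / h N =
      (c - b) * ∑ k ∈ range (N + 1), Q (p k) * R (p k) / h k - (Q (p 0) - R (p 0)) := by
  have hp0 : p 0 = 1 := (hm 0).natDegree_eq_zero.1 (hd 0)
  have hL0 : L (p 0) = h 0 := by rw [← hh, hp0, mul_one]
  have hL (k : ℕ) : L (p (k + 1)) = 0 := by
    rw [← ho (k + 1) 0 (by omega), hp0, mul_one]
  have hC (k : ℕ) : (h k : ℂ) ≠ 0 := by exact_mod_cast hh0 k
  induction N with
  | zero =>
    obtain ⟨α, hα⟩ := recurrence_zero hm hd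
    have h1 := hQ (p 0)
    have h2 := hR (p 0)
    rw [hα, map_add, map_smul, hL0, Complex.real_smul] at h1 h2
    have := hC 0
    simp only [zero_add, range_one, sum_singleton]
    field_simp
    linear_combination R (p 0) * h1 - Q (p 0) * h2
  | succ N ih =>
    obtain ⟨α, hα⟩ := recurrence_succ hm hd ho hh hh0 N
    have h1 := hQ (p (N + 1))
    have h2 := hR (p (N + 1))
    rw [hα, map_add, map_add, map_smul, map_smul, hL, Complex.real_smul, Complex.real_smul]
      at h1 h2
    push_cast at h1 h2
    have h3 := hC N
    have h4 := hC (N + 1)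
    rw [sum_range_succ, mul_add, add_sub_right_comm, ← ih]
    field_simp at h1 h2 ⊢
    linear_combination R (p (N + 1)) * h1 - Q (p (N + 1)) * h2

end Orthogonal

section Determinants

open Polynomial Matrix

/-- Andréief's identity. -/
lemma integral_det_mul_det {ι : Type*} [Fintype ι] [DecidableEq ι] (f g : ι → ℝ → ℂ)
    (w : ℝ → ℂ) (hfg : ∀ a b, Integrable fun t => f a t * g b t * w t) :
    ∫ x : ι → ℝ, (of fun i a => f a (x i)).det * (of fun i a => g a (x i)).det * ∏ i, w (x i) =
      (Fintype.card ι).factorial * (of fun a b => ∫ t, f a t * g b t * w t).det := by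
  have hint (σ τ : Equiv.Perm ι) : Integrable fun x : ι → ℝ =>
      ∏ i, f (σ i) (x i) * g (τ i) (x i) * w (x i) :=
    Integrable.fintype_prod (f := fun i t => f (σ i) t * g (τ i) t * w t)
      fun i => hfg (σ i) (τ i)
  have h1 (x : ι → ℝ) :
      (of fun i a => f a (x i)).det * (of fun i a => g a (x i)).det * ∏ i, w (x i) =
      ∑ σ : Equiv.Perm ι, ∑ τ : Equiv.Perm ι, ((σ.sign : ℤ) : ℂ) * ((τ.sign : ℤ) : ℂ) *
        ∏ i, f (σ i) (x i) * g (τ i) (x i) * w (x i) := by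
    rw [← det_transpose, ← det_transpose (of fun i a => g a (x i)), det_apply', det_apply',
      sum_mul_sum, sum_mul]
    refine sum_congr rfl fun σ _ => ?_
    rw [sum_mul]
    refine sum_congr rfl fun τ _ => ?_
    simp only [prod_mul_distrib, transpose_apply, of_apply]
    ring
  simp_rw [h1]
  rw [integral_finsetSum _ fun σ _ => integrable_finsetSum _ fun τ _ => (hint σ τ).const_mul _]
  have h2 (σ : Equiv.Perm ι) : ∫ x : ι → ℝ, ∑ τ : Equiv.Perm ι, ((σ.sign : ℤ) : ℂ) *
        ((τ.sign : ℤ) : ℂ) * ∏ i, f (σ i) (x i) * g (τ i) (x i) * w (x i) =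
      (of fun a b => ∫ t, f a t * g b t * w t).det := by
    rw [integral_finsetSum _ fun τ _ => (hint σ τ).const_mul _, ← det_transpose]
    have h3 := det_permute σ ((of fun a b => ∫ t, f a t * g b t * w t))
    have hs : ((σ.sign : ℤ) : ℂ) * ((σ.sign : ℤ) : ℂ) = 1 := by
      rcases Int.units_eq_one_or σ.sign with h | h <;> simp [h]
    rw [det_transpose, ← one_mul (det _), ← hs, mul_assoc, ← h3, ← det_transpose, det_apply',
      mul_sum]
    refine sum_congr rfl fun τ _ => ?_
    rw [integral_const_mul,
      integral_fintype_prod_volume_eq_prod fun i t => f (σ i) t * g (τ i) t * w t, mul_assoc]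
    rfl
  simp_rw [h2]
  rw [sum_const, card_univ, Fintype.card_perm, nsmul_eq_mul]

lemma det_vandermonde_eq_prod_lt {m : ℕ} (v : Fin m → ℂ) :
    (vandermonde v).det =
      ∏ q ∈ univ.filter (fun q : Fin m × Fin m => q.1 < q.2), (v q.2 - v q.1) := by
  rw [det_vandermonde, prod_filter, ← univ_product_univ, prod_product]
  refine prod_congr rfl fun i _ => ?_
  rw [← prod_filter]
  exact prod_congr (by ext; simp) fun _ _ => rfl

lemma det_vandermonde_mul_self {m : ℕ} (x : Fin m → ℝ) :
    (vandermonde fun i => (x i : ℂ)).det * (vandermonde fun i => (x i : ℂ)).det =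
      ((vdmR x ^ 2 : ℝ) : ℂ) := by
  rw [det_vandermonde_eq_prod_lt, ← prod_mul_distrib, vdmR, ← prod_pow]
  push_cast
  exact prod_congr rfl fun _ _ => by ring

lemma prod_prod_erase_sub {m : ℕ} (v : Fin m → ℂ) :
    ∏ i, ∏ k ∈ univ.erase i, (v i - v k) = (vandermonde v).det * vdmC v := by
  have h1 : ∏ i, ∏ k ∈ univ.erase i, (v i - v k) = ∏ i, ∏ k, if i ≠ k then v i - v k else 1 := by
    refine prod_congr rfl fun i _ => ?_
    rw [← prod_filter]
    exact prod_congr (by ext; simp [eq_comm]) fun _ _ => rfl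
  rw [h1, ← prod_product', univ_product_univ, ← prod_filter,
    ← prod_filter_mul_prod_filter_not _ fun q : Fin m × Fin m => q.2 < q.1, filter_filter,
    filter_filter, det_vandermonde_eq_prod_lt, vdmC]
  congr 1
  · refine prod_nbij' Prod.swap Prod.swap ?_ ?_ ?_ ?_ ?_ <;> simp +contextual [ne_of_gt]
  · refine prod_congr ?_ fun _ _ => rfl
    ext q
    simp only [mem_filter, mem_univ, true_and]
    constructor
    · rintro ⟨h, h'⟩
      exact lt_of_le_of_ne (not_lt.1 h') h
    · exact fun h => ⟨h.ne, h.not_gt⟩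

lemma vdmC_ne_zero {m : ℕ} {v : Fin m → ℂ} (hv : Function.Injective v) : vdmC v ≠ 0 :=
  prod_ne_zero_iff.2 fun _ hq => sub_ne_zero.2 fun h => (mem_filter.1 hq).2.ne (hv h)

lemma eval_eq_sum_fin {S : ℕ} {Q : ℂ[X]} (hQ : Q.natDegree < S) (y : ℂ) :
    Q.eval y = ∑ i : Fin S, y ^ (i : ℕ) * Q.coeff i := by
  rw [eval_eq_sum_range' hQ, ← Fin.sum_univ_eq_sum_range fun l => Q.coeff l * y ^ l]
  exact sum_congr rfl fun l _ => mul_comm _ _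

/-- The coefficients of the polynomials `∏_{k ≠ j} (X - b_k)` form a matrix with determinant
`Δ(b)`. -/
lemma det_coeff_prod_erase {S : ℕ} (b : Fin S → ℂ) (hb : Function.Injective b) :
    (of fun i j : Fin S => (∏ k ∈ univ.erase j, (X - C (b k))).coeff i).det = vdmC b := by
  have hV : (vandermonde b).det ≠ 0 := det_vandermonde_ne_zero_iff.2 hb
  refine mul_left_cancel₀ hV ?_
  rw [← det_mul, ← prod_prod_erase_sub, ← det_diagonal]
  congr 1
  ext i j
  have hdeg : (∏ k ∈ univ.erase j, (X - C (b k))).natDegree < S := by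
    rw [natDegree_finsetProd_X_sub_C_eq_card, card_erase_of_mem (mem_univ j), card_univ,
      Fintype.card_fin]
    exact Nat.sub_lt (Fin.pos j) one_pos
  have h1 : (vandermonde b * of fun i j : Fin S =>
      (∏ k ∈ univ.erase j, (X - C (b k))).coeff i) i j =
      (∏ k ∈ univ.erase j, (X - C (b k))).eval (b i) := by
    rw [eval_eq_sum_fin hdeg, mul_apply]
    exact sum_congr rfl fun l _ => by simp
  rw [h1, eval_prod]
  simp only [eval_sub, eval_X, eval_C]
  rcases eq_or_ne i j with rfl | hij
  · rw [diagonal_apply_eq]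
  · rw [diagonal_apply_ne _ hij]
    exact prod_eq_zero (mem_erase.2 ⟨hij, mem_univ i⟩) (sub_self _)

/-- A mixed Cauchy–Vandermonde determinant. -/
lemma det_cauchy_vandermonde {S N : ℕ} (b : Fin S → ℂ) (hb : Function.Injective b)
    (P : ℕ → ℂ[X]) (hm : ∀ k, (P k).Monic) (hd : ∀ k, (P k).natDegree = k)
    (x : Fin (S + N) → ℂ) (hx : ∀ i j, x i ≠ b j) :
    (of fun i a : Fin (S + N) => Sum.elim (fun j => (x i - b j)⁻¹)
      (fun k : Fin N => (P k).eval (x i)) (finSumFinEquiv.symm a)).det =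
      (vandermonde x).det * vdmC b * (∏ j, ∏ i, (x i - b j))⁻¹ := by
  set B : ℂ[X] := ∏ j, (X - C (b j)) with hB
  have hBm : B.Monic := monic_prod_X_sub_C _ _
  have hBd : B.natDegree = S := by
    rw [hB, natDegree_finsetProd_X_sub_C_eq_card, card_univ, Fintype.card_fin]
  have hBe (i) : B.eval (x i) = ∏ j, (x i - b j) := by simp [hB, eval_prod]
  let R : Fin (S + N) → ℂ[X] := fun a =>
    Sum.elim (fun m : Fin S => X ^ (m : ℕ)) (fun k : Fin N => B * P k) (finSumFinEquiv.symm a)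
  have hR : (vandermonde x).det = (of fun i a => (R a).eval (x i)).det := by
    refine det_eval_matrixOfPolynomials_eq_det_vandermonde x R (fun a => ?_) fun a => ?_
    · obtain ⟨s, rfl⟩ := finSumFinEquiv.surjective a
      rcases s with s | s
      · simp [R]
      · simp [R, hBm.natDegree_mul (hm _), hBd, hd]
    · obtain ⟨s, rfl⟩ := finSumFinEquiv.surjective a
      rcases s with s | s
      · simp [R]
      · simpa [R] using hBm.mul (hm _)
  have key : (of fun i a : Fin (S + N) => B.eval (x i) * Sum.elim (fun j => (x i - b j)⁻¹)
      (fun k : Fin N => (P k).eval (x i)) (finSumFinEquiv.symm a)) =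
      (of fun i a => (R a).eval (x i)) * (fromBlocks (of fun i j : Fin S =>
        (∏ k ∈ univ.erase j, (X - C (b k))).coeff i) 0 0 1).submatrix finSumFinEquiv.symm
          finSumFinEquiv.symm := by
    ext i a
    obtain ⟨s, rfl⟩ := finSumFinEquiv.surjective a
    rw [mul_apply, ← finSumFinEquiv.sum_comp, Fintype.sum_sum_type]
    rcases s with j | k
    · have hdeg : (∏ k ∈ univ.erase j, (X - C (b k))).natDegree < S := by
        rw [natDegree_finsetProd_X_sub_C_eq_card, card_erase_of_mem (mem_univ j), card_univ,
          Fintype.card_fin]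
        exact Nat.sub_lt (Fin.pos j) one_pos
      have h1 : B.eval (x i) * (x i - b j)⁻¹ =
          (∏ k ∈ univ.erase j, (X - C (b k))).eval (x i) := by
        rw [hB, ← mul_prod_erase univ _ (mem_univ j), eval_mul]
        have := sub_ne_zero.2 (hx i j)
        simp only [eval_sub, eval_X, eval_C]
        field_simp
      simp only [of_apply, Equiv.symm_apply_apply, Sum.elim_inl, submatrix_apply,
        fromBlocks_apply₁₁, fromBlocks_apply₂₁, Matrix.zero_apply, mul_zero, sum_const_zero, add_zero,
        R, eval_pow, eval_X]
      rw [h1, eval_eq_sum_fin hdeg]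
    · simp [R, one_apply]
  have hdet := congrArg det key
  have hrow := det_mul_column (fun i => B.eval (x i)) (of fun i a : Fin (S + N) =>
    Sum.elim (fun j => (x i - b j)⁻¹) (fun k : Fin N => (P k).eval (x i)) (finSumFinEquiv.symm a))
  simp only [of_apply] at hrow
  rw [hrow, det_mul, ← hR, det_submatrix_equiv_self, det_fromBlocks_zero₂₁, det_one, mul_one,
    det_coeff_prod_erase b hb] at hdet
  rw [← hdet, prod_comm]
  simp_rw [hBe]
  have : ∏ i, ∏ j, (x i - b j) ≠ 0 :=
    prod_ne_zero_iff.2 fun i _ => prod_ne_zero_iff.2 fun j _ => sub_ne_zero.2 (hx i j)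
  field_simp

end Determinants

section CauchyTransform

open Polynomial

lemma integrable_eval_mul {w : ℝ → ℝ} (hw_meas : Measurable w)
    (hw_moments : ∀ k : ℕ, Integrable (fun x : ℝ => |x| ^ k * w x)) (P : ℝ[X]) :
    Integrable fun x => P.eval x * w x := by
  have h1 (k : ℕ) : Integrable fun x : ℝ => x ^ k * w x := by
    refine (hw_moments k).mono (by fun_prop) (.of_forall fun x => ?_)
    simp
  simp_rw [eval_eq_sum_range, sum_mul, mul_assoc]
  exact integrable_finsetSum _ fun k _ => (h1 k).const_mul _

lemma integrable_coe {f : ℝ → ℝ} (hf : Integrable f) : Integrable fun x => (f x : ℂ) :=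
  hf.ofReal

lemma norm_inv_ofReal_sub_le (z : ℂ) (hz : z.im ≠ 0) (x : ℝ) : ‖((x : ℂ) - z)⁻¹‖ ≤ |z.im|⁻¹ := by
  rw [norm_inv]
  refine inv_anti₀ (abs_pos.2 hz) ?_
  simpa using Complex.abs_im_le_norm ((x : ℂ) - z)

lemma ofReal_sub_ne_zero {z : ℂ} (hz : z.im ≠ 0) (x : ℝ) : (x : ℂ) - z ≠ 0 := fun h => by
  have := congrArg Complex.im h
  simp at this
  exact hz this

lemma integrable_mul_inv_sub {f : ℝ → ℂ} (hf : Integrable f) {z : ℂ} (hz : z.im ≠ 0) :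
    Integrable fun x => f x * ((x : ℂ) - z)⁻¹ :=
  hf.mul_bdd (Measurable.aestronglyMeasurable (by fun_prop))
    (.of_forall (norm_inv_ofReal_sub_le z hz))

/-- Integration of polynomials against the weight `w`. -/
noncomputable def weightFunctional (w : ℝ → ℝ)
    (hw : ∀ P : ℝ[X], Integrable fun x => P.eval x * w x) : ℝ[X] →ₗ[ℝ] ℝ where
  toFun P := ∫ x, P.eval x * w x
  map_add' P Q := by
    simp_rw [eval_add, add_mul]
    exact integral_add (hw P) (hw Q)
  map_smul' a P := by
    simp_rw [eval_smul, smul_eq_mul, mul_assoc, integral_const_mul, RingHom.id_apply]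

/-- The Cauchy transform at `z` of polynomials times the weight `w`. -/
noncomputable def cauchyFunctional (w : ℝ → ℝ)
    (hw : ∀ P : ℝ[X], Integrable fun x => P.eval x * w x) (z : ℂ) (hz : z.im ≠ 0) :
    ℝ[X] →ₗ[ℝ] ℂ where
  toFun P := ∫ x : ℝ, ((P.eval x * w x : ℝ) : ℂ) / ((x : ℂ) - z)
  map_add' P Q := by
    simp_rw [eval_add, add_mul, Complex.ofReal_add, add_div]
    have h1 (R : ℝ[X]) : Integrable fun x : ℝ => ((R.eval x * w x : ℝ) : ℂ) / ((x : ℂ) - z) := by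
      simpa only [div_eq_mul_inv] using integrable_mul_inv_sub (integrable_coe (hw R)) hz
    exact integral_add (h1 P) (h1 Q)
  map_smul' a P := by
    rw [RingHom.id_apply, Complex.real_smul, ← integral_const_mul]
    refine integral_congr_ae (.of_forall fun x => ?_)
    simp only [eval_smul, smul_eq_mul]
    push_cast
    ring

lemma cauchyFunctional_X_mul {w : ℝ → ℝ}
    (hw : ∀ P : ℝ[X], Integrable fun x => P.eval x * w x) {z : ℂ} (hz : z.im ≠ 0) (P : ℝ[X]) :
    cauchyFunctional w hw z hz (X * P) =
      z * cauchyFunctional w hw z hz P + weightFunctional w hw P := by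
  have h1 : Integrable fun x : ℝ => ((P.eval x * w x : ℝ) : ℂ) / ((x : ℂ) - z) := by
    simpa only [div_eq_mul_inv] using integrable_mul_inv_sub (integrable_coe (hw P)) hz
  change ∫ x : ℝ, (((X * P).eval x * w x : ℝ) : ℂ) / ((x : ℂ) - z) =
    z * (∫ x : ℝ, ((P.eval x * w x : ℝ) : ℂ) / ((x : ℂ) - z)) + ((∫ x, P.eval x * w x : ℝ) : ℂ)
  rw [← integral_const_mul, ← integral_complex_ofReal,
    ← integral_add (h1.const_mul z) (integrable_coe (hw P))]
  refine integral_congr_ae (.of_forall fun x => ?_)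
  have := ofReal_sub_ne_zero hz x
  simp only [eval_mul, eval_X, Complex.ofReal_mul]
  field_simp
  ring

lemma integral_inv_mul_inv {w : ℝ → ℝ}
    (hw : ∀ P : ℝ[X], Integrable fun x => P.eval x * w x) {b c : ℂ} (hb : b.im ≠ 0)
    (hc : c.im ≠ 0) (hcb : c ≠ b) :
    ∫ x : ℝ, ((x : ℂ) - c)⁻¹ * ((x : ℂ) - b)⁻¹ * (w x : ℂ) =
      (cauchyFunctional w hw c hc 1 - cauchyFunctional w hw b hb 1) / (c - b) := by
  have h1 {z : ℂ} (hz : z.im ≠ 0) :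
      Integrable fun x : ℝ => (((1 : ℝ[X]).eval x * w x : ℝ) : ℂ) / ((x : ℂ) - z) := by
    simpa only [div_eq_mul_inv] using integrable_mul_inv_sub (integrable_coe (hw 1)) hz
  change _ = ((∫ x : ℝ, (((1 : ℝ[X]).eval x * w x : ℝ) : ℂ) / ((x : ℂ) - c)) -
    ∫ x : ℝ, (((1 : ℝ[X]).eval x * w x : ℝ) : ℂ) / ((x : ℂ) - b)) / (c - b)
  rw [← integral_sub (h1 hc) (h1 hb), ← integral_div]
  refine integral_congr_ae (.of_forall fun x => ?_)
  have h2 := ofReal_sub_ne_zero hc x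
  have h3 := ofReal_sub_ne_zero hb x
  have h4 := sub_ne_zero.2 hcb
  simp only [eval_one, one_mul]
  field_simp
  ring

end CauchyTransform

section Averages

open Polynomial Matrix

lemma eval_map_ofReal (P : ℝ[X]) (x : ℝ) :
    (P.map (algebraMap ℝ ℂ)).eval (x : ℂ) = ((P.eval x : ℝ) : ℂ) := by
  rw [eval_map_algebraMap, ← Complex.coe_algebraMap, aeval_algebraMap_apply,
    Complex.coe_algebraMap, coe_aeval_eq_eval]

/-- The partition function in terms of the norms of the monic orthogonal polynomials. -/
lemma partition_function_eq {w : ℝ → ℝ} (hw : ∀ P : ℝ[X], Integrable fun x => P.eval x * w x)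
    {p : ℕ → ℝ[X]} {h : ℕ → ℝ} (hm : ∀ k, (p k).Monic) (hd : ∀ k, (p k).natDegree = k)
    (ho : ∀ j k, j ≠ k → ∫ x, (p j).eval x * (p k).eval x * w x = 0)
    (hh : ∀ k, ∫ x, (p k).eval x * (p k).eval x * w x = h k) (n : ℕ) :
    ((∫ x : Fin n → ℝ, (vdmR x) ^ 2 * ∏ i, w (x i) : ℝ) : ℂ) =
      n.factorial * ∏ k ∈ range n, (h k : ℂ) := by
  have hprod (j k : ℕ) (t : ℝ) : (((p j).eval t : ℝ) : ℂ) * (((p k).eval t : ℝ) : ℂ) * (w t : ℂ) =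
      (((p j).eval t * (p k).eval t * w t : ℝ) : ℂ) := by push_cast; rfl
  have key := integral_det_mul_det (fun (a : Fin n) t => (((p a).eval t : ℝ) : ℂ))
    (fun (a : Fin n) t => (((p a).eval t : ℝ) : ℂ)) (fun t => (w t : ℂ)) (fun a b => by
      simp_rw [hprod]
      simpa using integrable_coe (hw (p a * p b)))
  have hdet (x : Fin n → ℝ) : (of fun i a : Fin n => (((p a).eval (x i) : ℝ) : ℂ)).det =
      (vandermonde fun i => (x i : ℂ)).det := by
    rw [det_eval_matrixOfPolynomials_eq_det_vandermonde _
      (fun a : Fin n => (p a).map (algebraMap ℝ ℂ)) (by simp [hd]) fun a => (hm a).map _]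
    simp_rw [eval_map_ofReal]
  have hdiag : (of fun a b : Fin n => ∫ t, (((p a).eval t : ℝ) : ℂ) * (((p b).eval t : ℝ) : ℂ) *
      (w t : ℂ)) = diagonal fun k : Fin n => (h k : ℂ) := by
    ext a b
    simp_rw [of_apply, hprod, integral_complex_ofReal]
    rcases eq_or_ne a b with rfl | hab
    · rw [diagonal_apply_eq, hh]
    · rw [diagonal_apply_ne _ hab, ho _ _ (by simpa [Fin.ext_iff] using hab), Complex.ofReal_zero]
  rw [hdiag, det_diagonal, Fintype.card_fin, Fin.prod_univ_eq_prod_range fun k => (h k : ℂ)] at key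
  rw [← key, ← integral_complex_ofReal]
  refine integral_congr_ae (.of_forall fun x => ?_)
  simp only [hdet, det_vandermonde_mul_self]
  push_cast
  rfl

/-- The unnormalised average of inverse characteristic polynomials as a determinant of
Christoffel–Darboux type. -/
lemma integral_inv_charpoly {w : ℝ → ℝ}
    (hw : ∀ P : ℝ[X], Integrable fun x => P.eval x * w x)
    {p : ℕ → ℝ[X]} {h : ℕ → ℝ} (hm : ∀ k, (p k).Monic) (hd : ∀ k, (p k).natDegree = k)
    (ho : ∀ j k, j ≠ k → ∫ x, (p j).eval x * (p k).eval x * w x = 0)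
    (hh : ∀ k, ∫ x, (p k).eval x * (p k).eval x * w x = h k) (hh0 : ∀ k, h k ≠ 0)
    {S N : ℕ} {b c : Fin S → ℂ} (hb : Function.Injective b) (hc : Function.Injective c)
    (hb_im : ∀ j, (b j).im ≠ 0) (hc_im : ∀ l, (c l).im ≠ 0) :
    ∫ x : Fin (S + N) → ℝ, (∏ j : Fin S, ∏ i, (1 : ℂ) / ((b j - (x i : ℂ)) * (c j - (x i : ℂ)))) *
        (((vdmR x) ^ 2 * ∏ i, w (x i) : ℝ) : ℂ) =
      (S + N).factorial * ((∏ k ∈ range N, (h k : ℂ)) *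
        (of fun l j : Fin S => (∫ x : ℝ, ((x : ℂ) - c l)⁻¹ * ((x : ℂ) - b j)⁻¹ * (w x : ℂ)) -
          ∑ k ∈ range N, qhat w p k (c l) * qhat w p k (b j) / h k).det) /
        (vdmC c * vdmC b) := by
  let F (z : Fin S → ℂ) (a : Fin (S + N)) (t : ℝ) : ℂ := Sum.elim (fun j => ((t : ℂ) - z j)⁻¹)
    (fun k : Fin N => ((p k).map (algebraMap ℝ ℂ)).eval (t : ℂ)) (finSumFinEquiv.symm a)
  have hFl (z : Fin S → ℂ) (j t) : F z (finSumFinEquiv (.inl j)) t = ((t : ℂ) - z j)⁻¹ := by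
    simp only [F, Equiv.symm_apply_apply, Sum.elim_inl]
  have hFr (z : Fin S → ℂ) (k t) :
      F z (finSumFinEquiv (.inr k)) t = (((p k).eval t : ℝ) : ℂ) := by
    simp only [F, Equiv.symm_apply_apply, Sum.elim_inr, eval_map_ofReal]
  have hw1 : Integrable fun t => (w t : ℂ) := by simpa using integrable_coe (hw 1)
  have hint (a a') : Integrable fun t => F c a t * F b a' t * (w t : ℂ) := by
    obtain ⟨s, rfl⟩ := finSumFinEquiv.surjective a
    obtain ⟨s', rfl⟩ := finSumFinEquiv.surjective a'
    rcases s with l | k <;> rcases s' with j | k' <;> simp only [hFl, hFr]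
    · convert integrable_mul_inv_sub (integrable_mul_inv_sub hw1 (hc_im l)) (hb_im j) using 2
      ring
    · convert integrable_mul_inv_sub (integrable_coe (hw (p k'))) (hc_im l) using 2
      push_cast
      ring
    · convert integrable_mul_inv_sub (integrable_coe (hw (p k))) (hb_im j) using 2
      push_cast
      ring
    · convert integrable_coe (hw (p k * p k')) using 2
      simp
  have hdet (z : Fin S → ℂ) (hz : Function.Injective z) (hz_im : ∀ j, (z j).im ≠ 0)
      (x : Fin (S + N) → ℝ) : (of fun i a => F z a (x i)).det =
      (vandermonde fun i => (x i : ℂ)).det * vdmC z * (∏ j, ∏ i, ((x i : ℂ) - z j))⁻¹ :=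
    det_cauchy_vandermonde z hz (fun k => (p k).map (algebraMap ℝ ℂ)) (fun k => (hm k).map _)
      (by simp [hd]) _ fun i j => sub_ne_zero.1 (ofReal_sub_ne_zero (hz_im j) (x i))
  have hDet : (of fun a a' => ∫ t, F c a t * F b a' t * (w t : ℂ)).det =
      (∏ k ∈ range N, (h k : ℂ)) *
        (of fun l j : Fin S => (∫ x : ℝ, ((x : ℂ) - c l)⁻¹ * ((x : ℂ) - b j)⁻¹ * (w x : ℂ)) -
          ∑ k ∈ range N, qhat w p k (c l) * qhat w p k (b j) / h k).det := by
    have hC (k : ℕ) : (h k : ℂ) ≠ 0 := by exact_mod_cast hh0 k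
    let D : Matrix (Fin N) (Fin N) ℂ := diagonal fun k => (h k : ℂ)
    let D' : Matrix (Fin N) (Fin N) ℂ := diagonal fun k => (h k : ℂ)⁻¹
    let _ : Invertible D := ⟨D', by simp [D, D', hC], by simp [D, D', hC]⟩
    have hblock : (of fun a a' => ∫ t, F c a t * F b a' t * (w t : ℂ)).submatrix
        finSumFinEquiv finSumFinEquiv = fromBlocks
        (of fun l j : Fin S => ∫ x : ℝ, ((x : ℂ) - c l)⁻¹ * ((x : ℂ) - b j)⁻¹ * (w x : ℂ))
        (of fun l (k : Fin N) => qhat w p k (c l)) (of fun (k : Fin N) j => qhat w p k (b j))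
        D := by
      ext s s'
      rcases s with l | k <;> rcases s' with j | k' <;>
        simp only [submatrix_apply, of_apply, hFl, hFr, fromBlocks_apply₁₁, fromBlocks_apply₁₂,
          fromBlocks_apply₂₁, fromBlocks_apply₂₂, qhat]
      · refine integral_congr_ae (.of_forall fun x => ?_)
        push_cast
        ring
      · refine integral_congr_ae (.of_forall fun x => ?_)
        push_cast
        ring
      · have : ∫ t, (((p k).eval t : ℝ) : ℂ) * (((p k').eval t : ℝ) : ℂ) * (w t : ℂ) =
            ((∫ t, (p k).eval t * (p k').eval t * w t : ℝ) : ℂ) := by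
          rw [← integral_complex_ofReal]
          push_cast
          rfl
        rw [this]
        rcases eq_or_ne k k' with rfl | hk
        · simp [hh, D]
        · simp only [D]
          rw [diagonal_apply_ne _ hk, ho _ _ (by simpa [Fin.ext_iff] using hk),
            Complex.ofReal_zero]
    rw [← det_submatrix_equiv_self finSumFinEquiv, hblock, det_fromBlocks₂₂, det_diagonal,
      Fin.prod_univ_eq_prod_range fun k => (h k : ℂ)]
    congr 2
    ext l j
    rw [of_apply, Matrix.sub_apply, of_apply, Matrix.mul_assoc, mul_apply,
      ← Fin.sum_univ_eq_sum_range
      fun k => qhat w p k (c l) * qhat w p k (b j) / h k]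
    congr 1
    refine sum_congr rfl fun k _ => ?_
    rw [show ⅟D = D' from rfl, diagonal_mul, of_apply, of_apply]
    ring
  have key := integral_det_mul_det (F c) (F b) (fun t => (w t : ℂ)) hint
  rw [hDet, Fintype.card_fin] at key
  rw [← key, ← integral_div]
  refine integral_congr_ae (.of_forall fun x => ?_)
  have hvc := vdmC_ne_zero hc
  have hvb := vdmC_ne_zero hb
  simp only [hdet c hc hc_im, hdet b hb hb_im]
  have h1 : ∏ j : Fin S, ∏ i, (1 : ℂ) / ((b j - (x i : ℂ)) * (c j - (x i : ℂ))) =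
      (∏ j, ∏ i, ((x i : ℂ) - c j))⁻¹ * (∏ j, ∏ i, ((x i : ℂ) - b j))⁻¹ := by
    simp_rw [← prod_inv_distrib, ← prod_mul_distrib]
    refine prod_congr rfl fun j _ => prod_congr rfl fun i _ => ?_
    rw [← mul_inv, one_div]
    congr 1
    ring
  rw [h1, Complex.ofReal_mul, ← det_vandermonde_mul_self]
  push_cast
  field_simp

end Averages

/-- case [III] of Proposition 2.2 of the paper — averages of inverse
characteristic polynomials in terms of Cauchy transforms. -/
theorem stmt_15 (w : ℝ → ℝ) (hw_meas : Measurable w) (hw_nonneg : ∀ x, 0 ≤ w x)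
    (hw_moments : ∀ k : ℕ, Integrable (fun x : ℝ => |x| ^ k * w x))
    (hw_pos : 0 < ∫ x : ℝ, w x)
    (p : ℕ → Polynomial ℝ) (hp_monic : ∀ k, (p k).Monic)
    (hp_deg : ∀ k, (p k).natDegree = k)
    (hp_orth : ∀ j k, j ≠ k → ∫ x : ℝ, (p j).eval x * (p k).eval x * w x = 0)
    (h : ℕ → ℝ) (hh : ∀ k, h k = ∫ x : ℝ, ((p k).eval x) ^ 2 * w x)
    (hh_pos : ∀ k, 0 < h k)
    (n S : ℕ) (hS : 1 ≤ S) (hn : S + 1 ≤ n)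
    (b c : Fin S → ℂ) (hb : Function.Injective b) (hc : Function.Injective c)
    (hb_im : ∀ j, (b j).im ≠ 0) (hc_im : ∀ ℓ, (c ℓ).im ≠ 0)
    (hcb : ∀ ℓ j, c ℓ ≠ b j)
    (Z : ℝ) (hZ : Z = ∫ x : Fin n → ℝ, (vdmR x) ^ 2 * ∏ i, w (x i))
    (hZ_int : Integrable (fun x : Fin n → ℝ => (vdmR x) ^ 2 * ∏ i, w (x i)))
    (hZ_pos : 0 < Z) :
    (Z : ℂ)⁻¹ * ∫ x : Fin n → ℝ,
        (∏ j : Fin S, ∏ i : Fin n,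
          (1 : ℂ) / ((b j - (x i : ℂ)) * (c j - (x i : ℂ)))) *
        (((vdmR x) ^ 2 * ∏ i, w (x i) : ℝ) : ℂ)
      = (-1 : ℂ) ^ S *
        ((h (n - S - 1) : ℂ) ^ S * ((∏ ℓ ∈ Finset.Ico (n - S) n, h ℓ : ℝ) : ℂ))⁻¹ *
        Matrix.det (Matrix.of fun ℓ j : Fin S =>
          (qhat w p (n - S) (c ℓ) * qhat w p (n - S - 1) (b j) -
            qhat w p (n - S - 1) (c ℓ) * qhat w p (n - S) (b j)) / (c ℓ - b j)) /
        (vdmC c * vdmC b) := by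
  obtain ⟨N, rfl⟩ : ∃ N, n = S + (N + 1) := ⟨n - S - 1, by omega⟩
  have hw := integrable_eval_mul hw_meas hw_moments
  have hh' (k : ℕ) : ∫ x, (p k).eval x * (p k).eval x * w x = h k := by
    rw [hh]
    simp_rw [pow_two]
  have hh0 (k : ℕ) : h k ≠ 0 := (hh_pos k).ne'
  have hC (k : ℕ) : (h k : ℂ) ≠ 0 := by exact_mod_cast hh0 k
  rw [show S + (N + 1) - S = N + 1 by omega, Nat.add_sub_cancel,
    integral_inv_charpoly hw hp_monic hp_deg hp_orth hh' hh0 hb hc hb_im hc_im, hZ,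
    partition_function_eq hw hp_monic hp_deg hp_orth hh',
    ← prod_range_mul_prod_Ico (fun k => (h k : ℂ)) (by omega : N + 1 ≤ S + (N + 1))]
  have hp0 : p 0 = 1 := (hp_monic 0).natDegree_eq_zero.1 (hp_deg 0)
  have hq (k : ℕ) (z : ℂ) (hz : z.im ≠ 0) : qhat w p k z = cauchyFunctional w hw z hz (p k) := rfl
  have hmat : (Matrix.of fun l j : Fin S =>
      (∫ x : ℝ, ((x : ℂ) - c l)⁻¹ * ((x : ℂ) - b j)⁻¹ * (w x : ℂ)) -
        ∑ k ∈ range (N + 1), qhat w p k (c l) * qhat w p k (b j) / h k) =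
      (-(h N : ℂ)⁻¹) • Matrix.of fun ℓ j : Fin S =>
        (qhat w p (N + 1) (c ℓ) * qhat w p N (b j) -
          qhat w p N (c ℓ) * qhat w p (N + 1) (b j)) / (c ℓ - b j) := by
    ext l j
    have hcd := christoffel_darboux_functional (L := weightFunctional w hw) (h := h) hp_monic
      hp_deg (fun i k hik => by simpa [weightFunctional] using hp_orth i k hik)
      (fun k => by simpa [weightFunctional] using hh' k) hh0
      (cauchyFunctional_X_mul hw (hc_im l)) (cauchyFunctional_X_mul hw (hb_im j)) N
    have hne := sub_ne_zero.2 (hcb l j)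
    have hN := hC N
    rw [Matrix.smul_apply, Matrix.of_apply, Matrix.of_apply,
      integral_inv_mul_inv hw (hb_im j) (hc_im l) (hcb l j), ← hp0, smul_eq_mul]
    simp only [hq _ _ (hc_im l), hq _ _ (hb_im j)]
    rw [div_eq_iff hN] at hcd
    rw [hcd]
    field_simp
    ring
  rw [hmat, Matrix.det_smul, Fintype.card_fin]
  have h1 : ∏ k ∈ range (N + 1), (h k : ℂ) ≠ 0 := prod_ne_zero_iff.2 fun k _ => hC k
  have h2 : ∏ k ∈ Finset.Ico (N + 1) (S + (N + 1)), (h k : ℂ) ≠ 0 :=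
    prod_ne_zero_iff.2 fun k _ => hC k
  have h3 : ((S + (N + 1)).factorial : ℂ) ≠ 0 := by exact_mod_cast Nat.factorial_ne_zero _
  have h4 := hC N
  rw [neg_pow, inv_pow]
  push_cast
  field_simp
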